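/- Let x ∈ 𝒟 satisfy E_f(x) < min{ 1/a , 2/(b + √(b² + 4ab)) }, where a = (n−1)^{1/q} and b = 2^{1/q}. Then ‖W_f(𝒯(x))‖ ⪯ β(E_f(x))·‖W_f(x)‖ coordinatewise, where β(t) = (a t² (1 + a t)(1 + a + a t) / ((1 − a t)(1 − t − a t²))) · (1 + a t(1 + a t)/((n−1)(1 − b t − a b t²)))^{n−1}. (Lemma 4.4) -/

import Mathlib

open Finset Polynomial Filter

noncomputable section

/-- The Weierstrass correction `W_i(x) = f(x_i)/(C₀ ∏_{j≠i}(x_i − x_j))`. -/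
def Wc {n : ℕ} {K : Type*} [NormedField K] (f : Polynomial K) (x : Fin n → K) (i : Fin n) : K :=
  eval (x i) f / (f.leadingCoeff * ∏ j ∈ univ.erase i, (x i - x j))

/-- `dmin x i = min_{j ≠ i} ‖x i - x j‖`. -/
def dmin {n : ℕ} {K : Type*} [NormedField K] (x : Fin n → K) (i : Fin n) : ℝ :=
  if h : (univ.erase i).Nonempty then (univ.erase i).inf' h fun j => ‖x i - x j‖ else 0

/-- `E_f(x)` : the ℓ^p norm of the vector `(‖W_i(x)‖ / d_i(x))_i`. -/
def Ef {n : ℕ} {K : Type*} [NormedField K] (p : ENNReal) (f : Polynomial K)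
    (x : Fin n → K) : ℝ :=
  ‖(WithLp.equiv p (Fin n → ℝ)).symm (fun i => ‖Wc f x i‖ / dmin x i)‖

/-- `σ_i(x) = Σ_{j≠i} W_j(x)/(x_i − x_j)`. -/
def sigmaf {n : ℕ} {K : Type*} [NormedField K] (f : Polynomial K) (x : Fin n → K)
    (i : Fin n) : K :=
  ∑ j ∈ univ.erase i, Wc f x j / (x i - x j)

/-- The Ehrlich iteration function. -/
def PhiE {n : ℕ} {K : Type*} [NormedField K] (f : Polynomial K) (x : Fin n → K) : Fin n → K :=
  fun i => x i - Wc f x i / (1 + sigmaf f x i)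

/-- The Prešić–Tanabe iteration function. -/
def TnbE {n : ℕ} {K : Type*} [NormedField K] (f : Polynomial K) (x : Fin n → K) : Fin n → K :=
  fun i => x i - Wc f x i * (1 - sigmaf f x i)

/-- `ξ` is a root vector of `f`, i.e. `f(z) = C₀ ∏ (z − ξᵢ)`. -/
def IsRootVector {n : ℕ} {K : Type*} [NormedField K] (f : Polynomial K) (ξ : Fin n → K) : Prop :=
  f = C f.leadingCoeff * ∏ i, (X - C (ξ i))

/-- `E_f(x)` in the case `p = ∞`: the max of `‖W_i(x)‖ / d_i(x)`. -/
def Einf {n : ℕ} {K : Type*} [NormedField K] (f : Polynomial K) (x : Fin n → K) : ℝ :=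
  if h : (univ : Finset (Fin n)).Nonempty then univ.sup' h fun i => ‖Wc f x i‖ / dmin x i else 0

theorem sum_le_card_rpow_mul_lp_norm {n : ℕ} (p q : ENNReal) (hp : 1 ≤ p) (hpq : p⁻¹ + q⁻¹ = 1)
    (r : Fin n → ℝ) (hr : ∀ i, 0 ≤ r i) (s : Finset (Fin n)) :
    ∑ i ∈ s, r i ≤ (s.card : ℝ) ^ (ENNReal.toReal q⁻¹) *
      ‖(WithLp.equiv p (Fin n → ℝ)).symm r‖ := by
  rcases eq_or_ne p ⊤ with rfl | hptop
  · have hq : q⁻¹ = 1 := by simpa using hpq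
    rw [hq, ENNReal.toReal_one, Real.rpow_one, PiLp.norm_eq_ciSup, ← nsmul_eq_mul]
    refine sum_le_card_nsmul _ _ _ fun i _ => ?_
    have h := le_ciSup (Set.finite_range fun i => ‖(WithLp.equiv ⊤ (Fin n → ℝ)).symm r i‖).bddAbove i
    exact (Real.le_norm_self (r i)).trans h
  · have hp1 : 1 ≤ p.toReal := by
      rw [← ENNReal.toReal_one]
      exact ENNReal.toReal_mono hptop hp
    have hp0 : 0 < p.toReal := by linarith
    have hq : ENNReal.toReal q⁻¹ = 1 - 1 / p.toReal := by
      have hqt : q⁻¹ ≠ ⊤ := fun h => by simp [h] at hpq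
      have hpt : p⁻¹ ≠ ⊤ := fun h => by simp [h] at hpq
      have h := congrArg ENNReal.toReal hpq
      rw [ENNReal.toReal_add hpt hqt, ENNReal.toReal_inv, ENNReal.toReal_one] at h
      rw [one_div]
      linarith
    have hnorm : ‖(WithLp.equiv p (Fin n → ℝ)).symm r‖ =
        (∑ i, r i ^ p.toReal) ^ (1 / p.toReal) := by
      rw [PiLp.norm_eq_sum hp0]
      refine congrArg (· ^ (1 / p.toReal)) (sum_congr rfl fun i _ => ?_)
      exact congrArg (· ^ p.toReal) (Real.norm_of_nonneg (hr i))
    have hs : 0 ≤ ∑ i ∈ s, r i := sum_nonneg fun i _ => hr i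
    have hpow := Real.rpow_sum_le_const_mul_sum_rpow_of_nonneg s hp1 fun i _ => hr i
    have hsub : ∑ i ∈ s, r i ^ p.toReal ≤ ∑ i, r i ^ p.toReal :=
      sum_le_sum_of_subset_of_nonneg (subset_univ s) fun i _ _ => Real.rpow_nonneg (hr i) _
    have hroot := Real.rpow_le_rpow (z := 1 / p.toReal) (by positivity)
      (hpow.trans (mul_le_mul_of_nonneg_left hsub (by positivity))) (by positivity)
    rw [← Real.rpow_mul hs, mul_one_div_cancel hp0.ne', Real.rpow_one,
      Real.mul_rpow (by positivity) (sum_nonneg fun i _ => Real.rpow_nonneg (hr i) _),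
      ← Real.rpow_mul (by positivity)] at hroot
    rw [hnorm, hq]
    convert hroot using 3
    field_simp

theorem dmin_le {n : ℕ} {K : Type*} [NormedField K] (x : Fin n → K) {i j : Fin n} (h : j ≠ i) :
    dmin x i ≤ ‖x i - x j‖ := by
  have hj : j ∈ univ.erase i := by simp [h]
  rw [dmin, dif_pos ⟨j, hj⟩]
  exact inf'_le _ hj

theorem dmin_pos {n : ℕ} {K : Type*} [NormedField K] (hn : 2 ≤ n) {x : Fin n → K}
    (hx : Function.Injective x) (i : Fin n) : 0 < dmin x i := by
  have hne : (univ.erase i).Nonempty := by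
    rw [← card_pos, card_erase_of_mem (mem_univ i), card_fin]
    omega
  rw [dmin, dif_pos hne, lt_inf'_iff]
  intro j hj
  exact norm_pos_iff.2 (sub_ne_zero.2 fun h => (ne_of_mem_erase hj) (hx h).symm)

theorem eval_eq_weierstrass_interpolation {n : ℕ} {K : Type*} [NormedField K] (f : Polynomial K)
    (hdeg : f.degree = (n : ℕ)) {x : Fin n → K} (hx : Function.Injective x) (z : K) :
    eval z f = f.leadingCoeff *
      (∏ j, (z - x j) + ∑ i, Wc f x i * ∏ j ∈ univ.erase i, (z - x j)) := by
  have hf : f ≠ 0 := by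
    rintro rfl
    simp at hdeg
  have hc : f.leadingCoeff ≠ 0 := leadingCoeff_ne_zero.2 hf
  have key : f - C f.leadingCoeff * Lagrange.nodal univ x =
      C f.leadingCoeff * ∑ i, C (Wc f x i) * Lagrange.nodal (univ.erase i) x := by
    refine Polynomial.eq_of_degrees_lt_of_eval_index_eq univ hx.injOn ?_ ?_ ?_
    · have hd : (C f.leadingCoeff * Lagrange.nodal univ x).degree = f.degree := by
        rw [degree_C_mul hc, Lagrange.degree_nodal, hdeg, card_fin]
      rw [card_fin, ← hdeg]
      refine degree_sub_lt_left hd.symm hf ?_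
      rw [leadingCoeff_mul, leadingCoeff_C, (Lagrange.nodal_monic).leadingCoeff, mul_one]
    · rw [degree_C_mul hc]
      refine (degree_sum_le _ _).trans_lt ?_
      rw [Finset.sup_lt_iff (WithBot.bot_lt_coe _)]
      intro i _
      refine (smul_eq_C_mul (Wc f x i) ▸ degree_smul_le (Wc f x i) _).trans_lt ?_
      rw [Lagrange.degree_nodal]
      exact_mod_cast card_erase_lt_of_mem (mem_univ i)
    · intro k _
      have hk : ∏ j ∈ univ.erase k, (x k - x j) ≠ 0 :=
        prod_ne_zero_iff.2 fun j hj => sub_ne_zero.2 fun h => (ne_of_mem_erase hj) (hx h).symm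
      simp only [eval_sub, eval_mul, eval_C, eval_finsetSum, Lagrange.eval_nodal]
      rw [prod_eq_zero (mem_univ k) (sub_self _), mul_zero, sub_zero, sum_eq_single k]
      · rw [Wc]
        field_simp
      · intro i _ hik
        rw [prod_eq_zero (mem_erase.2 ⟨hik.symm, mem_univ k⟩) (sub_self _), mul_zero]
      · simp
  have h := congrArg (eval z) key
  simp only [eval_sub, eval_mul, eval_C, eval_finsetSum, Lagrange.eval_nodal] at h
  linear_combination h

theorem eval_eq_prod_mul_correction {n : ℕ} {K : Type*} [NormedField K] (f : Polynomial K)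
    (hdeg : f.degree = (n : ℕ)) {x : Fin n → K} (hx : Function.Injective x) (z : K) (i : Fin n)
    (hz : ∀ j, j ≠ i → z - x j ≠ 0) :
    eval z f = f.leadingCoeff * (∏ j ∈ univ.erase i, (z - x j)) *
      ((z - x i) * (1 + ∑ j ∈ univ.erase i, Wc f x j / (z - x j)) + Wc f x i) := by
  rw [eval_eq_weierstrass_interpolation f hdeg hx z, ← mul_prod_erase univ _ (mem_univ i),
    ← add_sum_erase univ _ (mem_univ i)]
  have hsum : ∑ j ∈ univ.erase i, Wc f x j * ∏ k ∈ univ.erase j, (z - x k) =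
      (∏ j ∈ univ.erase i, (z - x j)) * (z - x i) *
        ∑ j ∈ univ.erase i, Wc f x j / (z - x j) := by
    rw [mul_sum]
    refine sum_congr rfl fun j hj => ?_
    have hj0 := hz j (ne_of_mem_erase hj)
    have h1 := mul_prod_erase univ (fun k => z - x k) (mem_univ j)
    have h2 := mul_prod_erase univ (fun k => z - x k) (mem_univ i)
    field_simp
    linear_combination Wc f x j * (h1 - h2)
  rw [hsum]
  ring

theorem prod_one_add_le_pow {ι : Type*} (s : Finset ι) (hs : s.Nonempty) (u : ι → ℝ)
    (hu : ∀ i ∈ s, 0 ≤ u i) {c : ℝ} (hc : ∑ i ∈ s, u i ≤ c) :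
    ∏ i ∈ s, (1 + u i) ≤ (1 + c / s.card) ^ s.card := by
  have hcard : (0 : ℝ) < s.card := by exact_mod_cast card_pos.2 hs
  have h0 : ∀ i ∈ s, 0 ≤ 1 + u i := fun i hi => by linarith [hu i hi]
  have amgm := Real.geom_mean_le_arith_mean s (fun _ => 1) (fun i => 1 + u i)
    (fun _ _ => zero_le_one) (by simpa using hs) h0
  simp only [Real.rpow_one, one_mul, sum_add_distrib, sum_const, nsmul_eq_mul, mul_one] at amgm
  rw [add_div, div_self hcard.ne'] at amgm
  have hle := pow_le_pow_left₀ (Real.rpow_nonneg (prod_nonneg h0) _) amgm s.card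
  rw [Real.rpow_inv_natCast_pow (prod_nonneg h0) (card_pos.2 hs).ne'] at hle
  have hsum : 0 ≤ ∑ i ∈ s, u i := sum_nonneg hu
  exact hle.trans (by gcongr)

theorem one_sub_mul_sub_mul_sq_pos {a b t : ℝ} (ha : 0 < a) (hb : 0 < b) (ht : 0 ≤ t)
    (h : t < 2 / (b + Real.sqrt (b ^ 2 + 4 * a * b))) : 0 < 1 - b * t - a * b * t ^ 2 := by
  set s := Real.sqrt (b ^ 2 + 4 * a * b) with hs
  have hs2 : s ^ 2 = b ^ 2 + 4 * a * b := Real.sq_sqrt (by positivity)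
  have hs0 : 0 ≤ s := Real.sqrt_nonneg _
  rw [lt_div_iff₀ (by positivity)] at h
  have h1 : 0 ≤ t * s := by positivity
  have h2 : t * s < 2 - b * t := by linarith
  have h3 : (t * s) ^ 2 < (2 - b * t) ^ 2 := by gcongr
  rw [mul_pow, hs2] at h3
  nlinarith

theorem norm_sum_div_le {ι : Type*} {K : Type*} [NormedField K] (s : Finset ι) (w y : ι → K)
    (d : ι → ℝ) {c B : ℝ} (hc : 0 < c) (hd : ∀ j ∈ s, 0 < d j) (hy : ∀ j ∈ s, d j * c ≤ ‖y j‖)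
    (hB : ∑ j ∈ s, ‖w j‖ / d j ≤ B) : ‖∑ j ∈ s, w j / y j‖ ≤ B / c := by
  refine (norm_sum_le _ _).trans (le_trans ?_ (div_le_div_of_nonneg_right hB hc.le))
  rw [sum_div]
  refine sum_le_sum fun j hj => ?_
  rw [norm_div, div_div]
  exact div_le_div_of_nonneg_left (norm_nonneg _) (mul_pos (hd j hj) hc) (hy j hj)

/-- Norm estimate for the Weierstrass correction at the Prešić–Tanabe image, from a bound `a * t`
on the punctured sums and a bound `b * t` on pairs of the numbers `‖Wc f x i‖ / dmin x i`. -/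
theorem norm_Wc_TnbE_le {n : ℕ} {K : Type*} [NormedField K] (hn : 2 ≤ n) (f : Polynomial K)
    (hdeg : f.degree = (n : ℕ)) {a b t : ℝ} (ha : 0 < a) (ht : 0 ≤ t)
    {x : Fin n → K} (hx : Function.Injective x)
    (hsum : ∀ i, ∑ j ∈ univ.erase i, ‖Wc f x j‖ / dmin x j ≤ a * t)
    (hpair : ∀ i j, i ≠ j → ‖Wc f x i‖ / dmin x i + ‖Wc f x j‖ / dmin x j ≤ b * t)
    (hone : ∀ i, ‖Wc f x i‖ / dmin x i ≤ t)
    (hD1 : 0 < 1 - t - a * t ^ 2) (hD : 0 < 1 - b * t - a * b * t ^ 2) (i : Fin n) :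
    ‖Wc f (TnbE f x) i‖ ≤ a * t ^ 2 * (1 + a + a * t) / (1 - t - a * t ^ 2) *
      (1 + a * t * (1 + a * t) / (((n : ℝ) - 1) * (1 - b * t - a * b * t ^ 2))) ^ (n - 1) *
        ‖Wc f x i‖ := by
  have hc : f.leadingCoeff ≠ 0 := leadingCoeff_ne_zero.2 fun h => by simp [h] at hdeg
  have hd := dmin_pos hn hx
  have hx0 : ∀ i j, j ≠ i → 0 < ‖x i - x j‖ := fun i j h => (hd i).trans_le (dmin_le x h)
  have hσ : ∀ i, ‖sigmaf f x i‖ ≤ a * t := fun i => by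
    simpa [sigmaf] using norm_sum_div_le (univ.erase i) (Wc f x) (fun j => x i - x j) (dmin x)
      one_pos (fun j _ => hd j)
      (fun j hj => by
        rw [mul_one, norm_sub_rev]
        exact dmin_le x (ne_of_mem_erase hj).symm) (hsum i)
  set y := TnbE f x with hy
  have hyi : ∀ i, y i - x i = -(Wc f x i * (1 - sigmaf f x i)) := fun i => by
    simp [hy, TnbE]
  have hat : 0 ≤ a * t := by positivity
  have hdisp : ∀ i, ‖y i - x i‖ ≤ (1 + a * t) * ‖Wc f x i‖ := fun i => by
    rw [hyi, norm_neg, norm_mul, mul_comm]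
    refine mul_le_mul_of_nonneg_right ?_ (norm_nonneg _)
    refine (norm_sub_le _ _).trans ?_
    rw [norm_one]
    linarith [hσ i]
  have hW : ∀ i j, j ≠ i → ‖Wc f x i‖ ≤ ‖Wc f x i‖ / dmin x i * ‖x i - x j‖ := fun i j h => by
    have := mul_le_mul_of_nonneg_left (dmin_le x h)
      (div_nonneg (norm_nonneg (Wc f x i)) (hd i).le)
    rwa [div_mul_cancel₀ _ (hd i).ne'] at this
  have hyx : ∀ i j, j ≠ i → ‖x i - x j‖ * (1 - t - a * t ^ 2) ≤ ‖y i - x j‖ := fun i j h => by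
    have htri : ‖x i - x j‖ ≤ ‖y i - x j‖ + ‖y i - x i‖ := by
      have := norm_sub_le (y i - x j) (y i - x i)
      rwa [show y i - x j - (y i - x i) = x i - x j by ring] at this
    have h1 : ‖Wc f x i‖ ≤ t * ‖x i - x j‖ := (hW i j h).trans (by gcongr; exact hone i)
    have h2 : (1 + a * t) * ‖Wc f x i‖ ≤ (1 + a * t) * (t * ‖x i - x j‖) := by gcongr
    linarith [hdisp i]
  have hyy : ∀ i j, j ≠ i → ‖x i - x j‖ * (1 - b * t - a * b * t ^ 2) ≤ ‖y i - y j‖ :=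
      fun i j h => by
    have htri : ‖x i - x j‖ ≤ ‖y i - y j‖ + ‖y i - x i‖ + ‖y j - x j‖ := by
      have h1 := norm_sub_le (y i - y j) (y i - x i)
      have h2 := norm_add_le (y i - y j - (y i - x i)) (y j - x j)
      rw [show y i - y j - (y i - x i) + (y j - x j) = x i - x j by ring] at h2
      linarith
    have h1 := hW j i h.symm
    rw [norm_sub_rev] at h1
    have h2 : ‖Wc f x i‖ + ‖Wc f x j‖ ≤ b * t * ‖x i - x j‖ :=
      (add_le_add (hW i j h) h1).trans (by rw [← add_mul]; gcongr; exact hpair i j h.symm)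
    have h3 : (1 + a * t) * (‖Wc f x i‖ + ‖Wc f x j‖) ≤
      (1 + a * t) * (b * t * ‖x i - x j‖) := by gcongr
    linarith [hdisp i, hdisp j]
  have hyx0 : ∀ j, j ≠ i → y i - x j ≠ 0 := fun j h =>
    norm_pos_iff.1 ((mul_pos (hx0 i j h) hD1).trans_le (hyx i j h))
  have hyy0 : ∀ j, j ≠ i → y i - y j ≠ 0 := fun j h =>
    norm_pos_iff.1 ((mul_pos (hx0 i j h) hD).trans_le (hyy i j h))
  set S := ∑ j ∈ univ.erase i, Wc f x j / (y i - x j) with hS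
  have hdx : ∀ j ∈ univ.erase i, dmin x j ≤ ‖x i - x j‖ := fun j hj => by
    rw [norm_sub_rev]
    exact dmin_le x (ne_of_mem_erase hj).symm
  have hSle : ‖S‖ ≤ a * t / (1 - t - a * t ^ 2) :=
    norm_sum_div_le _ _ _ (dmin x) hD1 (fun j _ => hd j)
      (fun j hj => (mul_le_mul_of_nonneg_right (hdx j hj) hD1.le).trans
        (hyx i j (ne_of_mem_erase hj))) (hsum i)
  have hdiff : ‖sigmaf f x i - S‖ ≤ a * t * (t * (1 + a * t)) / (1 - t - a * t ^ 2) := by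
    have heq : sigmaf f x i - S = ∑ j ∈ univ.erase i,
        (Wc f x j * ((y i - x i) / (x i - x j))) / (y i - x j) := by
      rw [sigmaf, hS, ← sum_sub_distrib]
      refine sum_congr rfl fun j hj => ?_
      have h1 := hyx0 j (ne_of_mem_erase hj)
      have h2 := norm_pos_iff.1 (hx0 i j (ne_of_mem_erase hj))
      field_simp
      ring
    rw [heq]
    refine norm_sum_div_le _ _ _ (dmin x) hD1 (fun j _ => hd j)
      (fun j hj => (mul_le_mul_of_nonneg_right (hdx j hj) hD1.le).trans
        (hyx i j (ne_of_mem_erase hj))) ?_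
    refine le_trans ?_ (mul_le_mul_of_nonneg_right (hsum i) (by positivity))
    rw [sum_mul]
    refine sum_le_sum fun j hj => ?_
    rw [norm_mul, mul_div_right_comm]
    refine mul_le_mul_of_nonneg_left ?_ (div_nonneg (norm_nonneg _) (hd j).le)
    have hji := ne_of_mem_erase hj
    rw [norm_div, div_le_iff₀ (hx0 i j hji)]
    have h1 : ‖Wc f x i‖ ≤ t * ‖x i - x j‖ := (hW i j hji).trans (by gcongr; exact hone i)
    have h2 : (1 + a * t) * ‖Wc f x i‖ ≤ (1 + a * t) * (t * ‖x i - x j‖) := by gcongr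
    linarith [hdisp i]
  have hbr : ‖(sigmaf f x i - S) + sigmaf f x i * S‖ ≤
      a * t ^ 2 * (1 + a + a * t) / (1 - t - a * t ^ 2) := by
    refine (norm_add_le _ _).trans ?_
    rw [norm_mul]
    refine (add_le_add hdiff (mul_le_mul (hσ i) hSle (norm_nonneg _) hat)).trans (le_of_eq ?_)
    field_simp
    ring
  have hfact : Wc f y i = ((sigmaf f x i - S) + sigmaf f x i * S) *
      (∏ j ∈ univ.erase i, (y i - x j) / (y i - y j)) * Wc f x i := by
    have hP : ∏ j ∈ univ.erase i, (y i - y j) ≠ 0 :=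
      prod_ne_zero_iff.2 fun j hj => hyy0 j (ne_of_mem_erase hj)
    rw [Wc, eval_eq_prod_mul_correction f hdeg hx (y i) i hyx0, ← hS, hyi, prod_div_distrib]
    field_simp
    ring
  have hcard : (univ.erase i).card = n - 1 := by rw [card_erase_of_mem (mem_univ i), card_fin]
  have hne : (univ.erase i).Nonempty := by
    rw [← card_pos, hcard]
    omega
  have hcast : ((n - 1 : ℕ) : ℝ) = (n : ℝ) - 1 := by
    rw [Nat.cast_sub (by omega), Nat.cast_one]
  have hprod : ‖∏ j ∈ univ.erase i, (y i - x j) / (y i - y j)‖ ≤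
      (1 + a * t * (1 + a * t) / (((n : ℝ) - 1) * (1 - b * t - a * b * t ^ 2))) ^ (n - 1) := by
    have hu : ∑ j ∈ univ.erase i, ‖(y j - x j) / (y i - y j)‖ ≤
        a * t * (1 + a * t) / (1 - b * t - a * b * t ^ 2) := by
      refine le_trans ?_ (div_le_div_of_nonneg_right
        (mul_le_mul_of_nonneg_right (hsum i) (by positivity)) hD.le)
      rw [sum_mul, sum_div]
      refine sum_le_sum fun j hj => ?_
      rw [norm_div, ← mul_div_right_comm, div_div, mul_comm ‖Wc f x j‖]
      exact div_le_div₀ (by positivity) (hdisp j) (mul_pos (hd j) hD)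
        ((mul_le_mul_of_nonneg_right (hdx j hj) hD.le).trans (hyy i j (ne_of_mem_erase hj)))
    have hamgm := prod_one_add_le_pow (univ.erase i) hne _ (fun j _ => norm_nonneg _) hu
    rw [hcard, hcast, div_div, mul_comm (1 - b * t - a * b * t ^ 2)] at hamgm
    rw [norm_prod]
    refine le_trans (prod_le_prod (fun j _ => norm_nonneg _) fun j hj => ?_) hamgm
    have h0 := hyy0 j (ne_of_mem_erase hj)
    rw [show (y i - x j) / (y i - y j) = 1 + (y j - x j) / (y i - y j) by field_simp; ring]
    refine (norm_add_le _ _).trans (by rw [norm_one])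
  rw [hfact, norm_mul, norm_mul]
  gcongr

/-- Proinov, Lemma 4.4. -/
theorem stmt_17 {n : ℕ} {K : Type*} [NormedField K] [CompleteSpace K] (hn : 2 ≤ n)
    (f : Polynomial K) (hdeg : f.degree = (n : ℕ))
    (p q : ENNReal) (hp : 1 ≤ p) (hpq : p⁻¹ + q⁻¹ = 1)
    (a b : ℝ) (ha : a = ((n : ℝ) - 1) ^ (ENNReal.toReal q⁻¹))
    (hb : b = (2 : ℝ) ^ (ENNReal.toReal q⁻¹))
    (β : ℝ → ℝ)
    (hβ : ∀ t, β t = a * t ^ 2 * (1 + a * t) * (1 + a + a * t) /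
        ((1 - a * t) * (1 - t - a * t ^ 2)) *
      (1 + a * t * (1 + a * t) / (((n : ℝ) - 1) * (1 - b * t - a * b * t ^ 2))) ^ (n - 1))
    (x : Fin n → K) (hx : Function.Injective x)
    (hE : Ef p f x < min (1 / a) (2 / (b + Real.sqrt (b ^ 2 + 4 * a * b)))) :
    ∀ i : Fin n, ‖Wc f (TnbE f x) i‖ ≤ β (Ef p f x) * ‖Wc f x i‖ := by
  have hn2 : (2 : ℝ) ≤ n := by exact_mod_cast hn
  have hq0 : 0 ≤ ENNReal.toReal q⁻¹ := ENNReal.toReal_nonneg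
  have ha1 : 1 ≤ a := ha ▸ Real.one_le_rpow (by linarith) hq0
  have hb1 : 1 ≤ b := hb ▸ Real.one_le_rpow (by norm_num) hq0
  have ha0 : 0 < a := by linarith
  have hb0 : 0 < b := by linarith
  have hr : ∀ i, 0 ≤ ‖Wc f x i‖ / dmin x i := fun i =>
    div_nonneg (norm_nonneg _) (dmin_pos hn hx i).le
  have hold := sum_le_card_rpow_mul_lp_norm p q hp hpq _ hr
  rw [lt_min_iff] at hE
  rw [hβ]
  change ∀ s : Finset (Fin n), ∑ i ∈ s, ‖Wc f x i‖ / dmin x i ≤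
    (s.card : ℝ) ^ (ENNReal.toReal q⁻¹) * Ef p f x at hold
  generalize Ef p f x = t at hE hold ⊢
  intro i
  have hone : ∀ i, ‖Wc f x i‖ / dmin x i ≤ t := fun i => by simpa using hold {i}
  have ht : 0 ≤ t := (hr i).trans (hone i)
  have hsum : ∀ i, ∑ j ∈ univ.erase i, ‖Wc f x j‖ / dmin x j ≤ a * t := fun i => by
    have h := hold (univ.erase i)
    rwa [card_erase_of_mem (mem_univ i), card_fin, Nat.cast_sub (by omega), Nat.cast_one,
      ← ha] at h
  have hpair : ∀ i j, i ≠ j → ‖Wc f x i‖ / dmin x i + ‖Wc f x j‖ / dmin x j ≤ b * t :=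
      fun i j h => by
    have h2 := hold {i, j}
    rwa [sum_pair h, card_pair h, Nat.cast_ofNat, ← hb] at h2
  have hD := one_sub_mul_sub_mul_sq_pos ha0 hb0 ht hE.2
  have hD1 : 0 < 1 - t - a * t ^ 2 := by
    have h : 0 ≤ (b - 1) * (t + a * t ^ 2) := mul_nonneg (by linarith) (by positivity)
    linarith
  have hat : 0 < 1 - a * t := by
    have h := (lt_div_iff₀ ha0).1 hE.1
    linarith
  refine (norm_Wc_TnbE_le hn f hdeg ha0 ht hx hsum hpair hone hD1 hD i).trans ?_
  have hn1 : (0 : ℝ) < n - 1 := by linarith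
  have hfac : a * t ^ 2 * (1 + a + a * t) / (1 - t - a * t ^ 2) ≤
      a * t ^ 2 * (1 + a * t) * (1 + a + a * t) / ((1 - a * t) * (1 - t - a * t ^ 2)) := by
    rw [show a * t ^ 2 * (1 + a * t) * (1 + a + a * t) / ((1 - a * t) * (1 - t - a * t ^ 2)) =
      (1 + a * t) / (1 - a * t) * (a * t ^ 2 * (1 + a + a * t) / (1 - t - a * t ^ 2)) by
        field_simp]
    refine le_mul_of_one_le_left (by positivity) ((one_le_div hat).2 ?_)
    linarith [mul_nonneg ha0.le ht]
  gcongr
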